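/- arXiv:2512.11396 — 5 statements merged into one kernel-verified Lean document; each statement's English description precedes it below -/
import Mathlib

section
/- Let d ∈ D with V(d) := {j : ⟨a_j, d⟩ > b_j} nonempty and b_j ≥ b_min for every j ∈ V(d). Let j̄ ∈ V(d) attain the minimum in α(d) := min_{j ∈ V(d)} b_j / ⟨a_j, d⟩, set δ := ⟨a_{j̄}, d⟩ − b_{j̄} > 0 and d̂ := α(d) · d. Then 1 − α(d) ≤ δ / b_{j̄} ≤ δ / b_min, and consequently ‖d − d̂‖₂ ≤ δ / b_min. -/
open scoped RealInnerProductSpace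

/-- **Distance bound between a violating point and its scaled-back version.**
With `V = {j | ⟪a j, d⟫ > b j}` nonempty, `b j ≥ b_min > 0` on `V`,
`j̄ ∈ V` attaining `α = min_{j ∈ V} b j / ⟪a j, d⟫`, `δ = ⟪a j̄, d⟫ − b j̄` and
`d̂ = α • d`, one has `1 − α ≤ δ / b j̄ ≤ δ / b_min` and `‖d − d̂‖ ≤ δ / b_min`. -/
theorem stmt_3 {n m l : ℕ} (p : EuclideanSpace ℝ (Fin n))
    (a : Fin l → EuclideanSpace ℝ (Fin n)) (b : Fin l → ℝ) (c : Fin l → ℝ)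
    (E : Matrix (Fin m) (Fin n) ℝ)
    (hb : ∀ j, 0 ≤ b j) (hc : ∀ j, 0 < c j)
    (bmin : ℝ) (hbminpos : 0 < bmin)
    (d : EuclideanSpace ℝ (Fin n))
    (hdE : E.mulVec d = 0) (hdnorm : ‖d‖ ≤ 1)
    (V : Finset (Fin l)) (hV : ∀ j, j ∈ V ↔ b j < ⟪a j, d⟫)
    (hVne : V.Nonempty)
    (hbmin : ∀ j ∈ V, bmin ≤ b j)
    (α : ℝ) (hα : α = V.inf' hVne (fun j => b j / ⟪a j, d⟫))
    (jbar : Fin l) (hjbar : jbar ∈ V)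
    (hjbarmin : α = b jbar / ⟪a jbar, d⟫)
    (δ : ℝ) (hδ : δ = ⟪a jbar, d⟫ - b jbar)
    (dhat : EuclideanSpace ℝ (Fin n)) (hdhat : dhat = α • d) :
    1 - α ≤ δ / b jbar ∧ δ / b jbar ≤ δ / bmin ∧ ‖d - dhat‖ ≤ δ / bmin := by
  have hviol : b jbar < ⟪a jbar, d⟫ := (hV jbar).1 hjbar
  have hbpos : 0 < b jbar := hbminpos.trans_le (hbmin jbar hjbar)
  have hinner : 0 < ⟪a jbar, d⟫ := hbpos.trans hviol
  have hδpos : 0 < δ := by rw [hδ]; exact sub_pos.2 hviol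
  have hgap : 1 - α = δ / ⟪a jbar, d⟫ := by
    rw [hjbarmin, hδ, sub_div, div_self hinner.ne']
  have hgap_nonneg : 0 ≤ 1 - α := by rw [hgap]; positivity
  have hgap_le : 1 - α ≤ δ / b jbar := by
    rw [hgap]; exact div_le_div_of_nonneg_left hδpos.le hbpos hviol.le
  have hle : δ / b jbar ≤ δ / bmin :=
    div_le_div_of_nonneg_left hδpos.le hbminpos (hbmin jbar hjbar)
  refine ⟨hgap_le, hle, ?_⟩
  calc ‖d - dhat‖ = (1 - α) * ‖d‖ := by
        rw [hdhat, ← norm_smul_of_nonneg hgap_nonneg, sub_smul, one_smul]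
    _ ≤ 1 - α := mul_le_of_le_one_right hgap_nonneg hdnorm
    _ ≤ δ / bmin := hgap_le.trans hle
end

section
/- Let d ∈ D with V(d) := {j : ⟨a_j, d⟩ > b_j} nonempty and b_j ≥ b_min for every j ∈ V(d). Let j̄ ∈ V(d) attain the minimum in α(d) := min_{j ∈ V(d)} b_j / ⟨a_j, d⟩, set δ := ⟨a_{j̄}, d⟩ − b_{j̄} > 0 and d̂ := α(d) · d. Then Φ(d) − Φ(d̂) ≥ (c_min − ‖p‖₂ / b_min) · δ; in particular, if c_min > ‖p‖₂ / b_min then Φ(d) > Φ(d̂). -/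
open scoped RealInnerProductSpace

/-- Scaling back by a factor in `[0, 1]` does not increase a hinge with nonnegative threshold. -/
lemma max_mul_le_max_of_le_one {α t b : ℝ} (hα₀ : 0 ≤ α) (hα₁ : α ≤ 1) (hb : 0 ≤ b) :
    max (α * t) b ≤ max t b := by
  refine max_le ?_ (le_max_right _ _)
  rcases le_total 0 t with ht | ht
  · exact (mul_le_of_le_one_left ht hα₁).trans (le_max_left _ _)
  · exact ((mul_nonpos_of_nonneg_of_nonpos hα₀ ht).trans hb).trans (le_max_right _ _)

/-- **Strict decrease of the penalized objective after scaling back.**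
With `V = {j | ⟪a j, d⟫ > b j}` nonempty, `b j ≥ b_min > 0` on `V`,
`j̄ ∈ V` attaining `α = min_{j ∈ V} b j / ⟪a j, d⟫`, `δ = ⟪a j̄, d⟫ − b j̄ > 0`
and `d̂ = α • d`, one has `Φ d − Φ d̂ ≥ (c_min − ‖p‖/b_min) δ`; in particular
if `c_min > ‖p‖/b_min` then `Φ d > Φ d̂`. -/
theorem stmt_4 {n m l : ℕ} (p : EuclideanSpace ℝ (Fin n))
    (a : Fin l → EuclideanSpace ℝ (Fin n)) (b : Fin l → ℝ) (c : Fin l → ℝ)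
    (E : Matrix (Fin m) (Fin n) ℝ)
    (hb : ∀ j, 0 ≤ b j) (hc : ∀ j, 0 < c j)
    (cmin bmin : ℝ) (hcmin : ∀ j, cmin ≤ c j) (hbminpos : 0 < bmin)
    (Φ : EuclideanSpace ℝ (Fin n) → ℝ)
    (hΦ : ∀ e, Φ e = ⟪p, e⟫ + ∑ j, c j * max ⟪a j, e⟫ (b j))
    (d : EuclideanSpace ℝ (Fin n))
    (hdE : E.mulVec d = 0) (hdnorm : ‖d‖ ≤ 1)
    (V : Finset (Fin l)) (hV : ∀ j, j ∈ V ↔ b j < ⟪a j, d⟫)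
    (hVne : V.Nonempty)
    (hbmin : ∀ j ∈ V, bmin ≤ b j)
    (α : ℝ) (hα : α = V.inf' hVne (fun j => b j / ⟪a j, d⟫))
    (jbar : Fin l) (hjbar : jbar ∈ V)
    (hjbarmin : α = b jbar / ⟪a jbar, d⟫)
    (δ : ℝ) (hδ : δ = ⟪a jbar, d⟫ - b jbar)
    (dhat : EuclideanSpace ℝ (Fin n)) (hdhat : dhat = α • d) :
    (cmin - ‖p‖ / bmin) * δ ≤ Φ d - Φ dhat ∧
      (‖p‖ / bmin < cmin → Φ dhat < Φ d) := by
  have hlt : b jbar < ⟪a jbar, d⟫ := (hV jbar).1 hjbar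
  have hbj : bmin ≤ b jbar := hbmin jbar hjbar
  have ht : 0 < ⟪a jbar, d⟫ := (hb jbar).trans_lt hlt
  have hδpos : 0 < δ := by rw [hδ]; linarith
  have hα₀ : 0 ≤ α := by rw [hjbarmin]; exact div_nonneg (hb jbar) ht.le
  have hα₁ : α ≤ 1 := by rw [hjbarmin]; exact (div_le_one ht).2 hlt.le
  have hαt : α * ⟪a jbar, d⟫ = b jbar := by rw [hjbarmin]; exact div_mul_cancel₀ _ ht.ne'
  have hgap : 1 - α ≤ δ / bmin := by
    rw [le_div_iff₀ hbminpos, hδ, ← hαt]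
    nlinarith
  have hlin : -(‖p‖ / bmin * δ) ≤ (1 - α) * ⟪p, d⟫ := by
    have hpd : -‖p‖ ≤ ⟪p, d⟫ :=
      (neg_le_neg (mul_le_of_le_one_right (norm_nonneg p) hdnorm)).trans
        (neg_le_of_abs_le (abs_real_inner_le_norm p d))
    calc -(‖p‖ / bmin * δ) = -(δ / bmin * ‖p‖) := by ring
      _ ≤ -((1 - α) * ‖p‖) := by gcongr
      _ = (1 - α) * -‖p‖ := by ring
      _ ≤ (1 - α) * ⟪p, d⟫ := mul_le_mul_of_nonneg_left hpd (sub_nonneg.2 hα₁)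
  have hpen : cmin * δ ≤ ∑ j, c j * (max ⟪a j, d⟫ (b j) - max (α * ⟪a j, d⟫) (b j)) :=
    calc cmin * δ ≤ c jbar * δ := mul_le_mul_of_nonneg_right (hcmin jbar) hδpos.le
      _ = c jbar * (max ⟪a jbar, d⟫ (b jbar) - max (α * ⟪a jbar, d⟫) (b jbar)) := by
        rw [hαt, max_self, max_eq_left hlt.le, hδ]
      _ ≤ _ := Finset.single_le_sum
        (f := fun j => c j * (max ⟪a j, d⟫ (b j) - max (α * ⟪a j, d⟫) (b j)))
        (fun j _ => mul_nonneg (hc j).le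
          (sub_nonneg.2 (max_mul_le_max_of_le_one hα₀ hα₁ (hb j))))
        (Finset.mem_univ jbar)
  have hmain : (cmin - ‖p‖ / bmin) * δ ≤ Φ d - Φ dhat := by
    simp only [mul_sub, Finset.sum_sub_distrib] at hpen
    simp only [hΦ, hdhat, inner_smul_right]
    linarith
  exact ⟨hmain, fun h => sub_pos.1 ((mul_pos (sub_pos.2 h) hδpos).trans_le hmain)⟩
end

section
/- Let A ∈ ℝ^{m×n}, B ∈ ℝ^{p×n} with linearly independent rows, and b ∈ ℝᵐ. Then exactly one of the following two systems has a solution: (a) there exists x ∈ ℝⁿ with A x < b componentwise and B x = 0; (b) there exist λ ∈ ℝᵐ and μ ∈ ℝᵖ, not both zero, with λ ≥ 0 componentwise, Aᵀλ + Bᵀμ = 0, and λᵀb ≤ 0. -/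
open Matrix

/-- A subspace of `ℝ^ι` that misses the open orthant `{y | y < b}` is annihilated by a nonzero
nonnegative vector whose pairing with `b` is nonpositive. -/
lemma exists_nonneg_dotProduct_eq_zero_of_forall_not_lt {ι : Type*} [Fintype ι]
    (T : Submodule ℝ (ι → ℝ)) (b : ι → ℝ) (hT : ∀ t ∈ T, ¬∀ i, t i < b i) :
    ∃ w : ι → ℝ, w ≠ 0 ∧ (∀ i, 0 ≤ w i) ∧ (∀ t ∈ T, w ⬝ᵥ t = 0) ∧ w ⬝ᵥ b ≤ 0 := by
  classical
  have hS : (Set.univ.pi fun i => Set.Iio (b i)) = {y : ι → ℝ | ∀ i, y i < b i} := by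
    ext y; simp
  have hconv : Convex ℝ {y : ι → ℝ | ∀ i, y i < b i} :=
    hS ▸ convex_pi fun i _ => convex_Iio (b i)
  have hopen : IsOpen {y : ι → ℝ | ∀ i, y i < b i} :=
    hS ▸ isOpen_set_pi Set.finite_univ fun i _ => isOpen_Iio
  obtain ⟨f, u, hfS, hfT⟩ := geometric_hahn_banach_open hconv hopen T.convex
    (Set.disjoint_left.2 fun y hy hyT => hT y hyT hy)
  have hu : u ≤ 0 := by simpa using hfT 0 T.zero_mem
  have hneg : ∀ y : ι → ℝ, (∀ i, y i < b i) → f y < 0 := fun y hy => (hfS y hy).trans_le hu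
  have hf : ∀ y, (fun i => f (Pi.single i 1)) ⬝ᵥ y = f y := by
    intro y
    conv_rhs => rw [pi_eq_sum_univ' y]
    simp [dotProduct, mul_comm]
  have hb : f b ≤ 0 := by
    by_contra! h
    have key : ∀ ε : ℝ, 0 < ε → f b < ε * f 1 := fun ε hε => by
      have := hneg (b - ε • 1) fun i => by simpa using hε
      simpa using this
    have h1 := key 1 one_pos
    have h2 := key (f b / f 1) (div_pos h (by linarith))
    rw [div_mul_cancel₀ _ (by linarith)] at h2
    exact h2.false
  refine ⟨fun i => f (Pi.single i 1), fun h0 => ?_, fun i => ?_, fun t ht => ?_,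
    (hf b).trans_le hb⟩
  · have := hneg (b - 1) fun i => by simp
    rw [← hf, h0, zero_dotProduct] at this
    exact this.false
  · by_contra! h
    have key : ∀ s : ℝ, 0 ≤ s → f (b - 1) < s * f (Pi.single i 1) := fun s hs => by
      have := hneg (b - 1 - s • Pi.single i 1) fun j => by
        have : 0 ≤ s * (Pi.single i 1 : ι → ℝ) j :=
          mul_nonneg hs (by rw [Pi.single_apply]; split_ifs <;> norm_num)
        simp only [Pi.sub_apply, Pi.smul_apply, smul_eq_mul, Pi.one_apply]
        linarith
      rw [map_sub, map_smul, smul_eq_mul] at this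
      linarith
    have h1 := key 0 le_rfl
    have h2 := key (f (b - 1) / f (Pi.single i 1)) (div_nonneg_of_nonpos (by linarith) h.le)
    rw [div_mul_cancel₀ _ h.ne] at h2
    exact h2.false
  · rw [hf]
    by_contra h
    have h1 := hfT (((u - 1) / f t) • t) (T.smul_mem _ ht)
    rw [map_smul, smul_eq_mul, div_mul_cancel₀ _ h] at h1
    linarith

/-- A linear form vanishing on the kernel of a matrix is a combination of its rows. -/
lemma exists_vecMul_eq_of_forall_mulVec_eq_zero {ι κ : Type*} [Fintype ι] [Fintype κ]
    (B : Matrix ι κ ℝ) (v : κ → ℝ) (h : ∀ x, B *ᵥ x = 0 → v ⬝ᵥ x = 0) :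
    ∃ c : ι → ℝ, c ᵥ* B = v := by
  have hmem := mem_span_of_iInf_ker_le_ker (L := fun i => dotProductBilin ℝ ℝ (B i))
    (K := dotProductBilin ℝ ℝ v) fun x hx => h x <| funext fun i => by
      simpa [mulVec] using (Submodule.mem_iInf _).1 hx i
  obtain ⟨c, hc⟩ := (Submodule.mem_span_range_iff_exists_fun ℝ).1 hmem
  refine ⟨c, dotProduct_eq _ _ fun x => ?_⟩
  rw [← dotProduct_mulVec]
  simpa [dotProduct, mulVec] using LinearMap.congr_fun hc x


/-- **Farkas-type alternative with equality constraints.** For `A ∈ ℝ^{m×n}`,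
`B ∈ ℝ^{p×n}` with linearly independent rows, and `b ∈ ℝᵐ`, exactly one of the
following holds: (a) `∃ x, A x < b` componentwise and `B x = 0`; (b) `∃ (λ, μ) ≠ 0`
with `λ ≥ 0`, `Aᵀλ + Bᵀμ = 0` and `λᵀb ≤ 0`. -/
theorem stmt_11 {m n p : ℕ} (A : Matrix (Fin m) (Fin n) ℝ)
    (B : Matrix (Fin p) (Fin n) ℝ) (hB : LinearIndependent ℝ B)
    (b : Fin m → ℝ) :
    Xor'
      (∃ x : Fin n → ℝ, (∀ i, A.mulVec x i < b i) ∧ B.mulVec x = 0)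
      (∃ (lam : Fin m → ℝ) (mu : Fin p → ℝ),
        ¬(lam = 0 ∧ mu = 0) ∧ (∀ i, 0 ≤ lam i) ∧
        Aᵀ.mulVec lam + Bᵀ.mulVec mu = 0 ∧ lam ⬝ᵥ b ≤ 0) := by
  refine xor_iff_or_and_not_and _ _ |>.2 ⟨?_, ?_⟩
  · by_contra! hnot
    obtain ⟨ha, hb⟩ := hnot
    obtain ⟨w, hw, hw0, hwT, hwb⟩ := exists_nonneg_dotProduct_eq_zero_of_forall_not_lt
      ((LinearMap.ker B.mulVecLin).map A.mulVecLin) b (by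
        rintro _ ⟨x, hx, rfl⟩ hlt
        exact ha x hlt hx)
    obtain ⟨c, hc⟩ := exists_vecMul_eq_of_forall_mulVec_eq_zero B (w ᵥ* A) fun x hx => by
      rw [← dotProduct_mulVec]
      exact hwT _ ⟨x, hx, rfl⟩
    refine (hb w (-c) (fun h => absurd h hw) hw0 ?_).not_ge hwb
    rw [mulVec_transpose, mulVec_transpose, neg_vecMul, hc, add_neg_cancel]
  · rintro ⟨⟨x, hx, hBx⟩, lam, mu, hne, hlam, heq, hle⟩
    rw [mulVec_transpose, mulVec_transpose] at heq
    have hzero : lam ⬝ᵥ A *ᵥ x = 0 := by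
      have := congrArg (· ⬝ᵥ x) heq
      simpa [add_dotProduct, ← dotProduct_mulVec, hBx] using this
    have hlam0 : lam = 0 := by
      by_contra h
      obtain ⟨i, hi⟩ := Function.ne_iff.1 h
      have : lam ⬝ᵥ A *ᵥ x < lam ⬝ᵥ b := Finset.sum_lt_sum
        (fun j _ => mul_le_mul_of_nonneg_left (hx j).le (hlam j))
        ⟨i, Finset.mem_univ i, mul_lt_mul_of_pos_left (hx i) ((hlam i).lt_of_ne' hi)⟩
      linarith
    rw [hlam0, zero_vecMul, zero_add] at heq
    exact hne ⟨hlam0, vecMul_injective_iff.2 hB (heq.trans (zero_vecMul B).symm)⟩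
end

section
/- Let p ∈ ℝⁿ, a₁,…,a_l ∈ ℝⁿ, v₁,…,v_m ∈ ℝⁿ, let g₁,…,g_l ≤ 0 be real numbers, and let M > 0. Suppose there exist NO multipliers λ₀ ≥ 0, λ₁,…,λ_l ≥ 0, μ₁,…,μ_m ∈ ℝ, not all zero, satisfying λ_j g_j = 0 for all j and λ₀ p + Σ_{j=1}^l λ_j a_j + Σ_{i=1}^m μ_i v_i = 0 (i.e., the point is not a Fritz–John point). Then there exists d ∈ ℝⁿ with ‖d‖₂ ≤ 1, ⟨v_i, d⟩ = 0 for every i = 1,…,m, ⟨p, d⟩ < 0, and ⟨a_j, d⟩ < −M g_j for every j = 1,…,l. -/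
open scoped RealInnerProductSpace

/-- A compact convex set disjoint from a closed subspace `W` lies in an open half-space whose
normal vector is orthogonal to `W`. -/
theorem exists_mem_orthogonal_forall_inner_neg {E : Type*} [NormedAddCommGroup E]
    [InnerProductSpace ℝ E] [CompleteSpace E] {S : Set E} (hconv : Convex ℝ S)
    (hcomp : IsCompact S) {W : Submodule ℝ E} (hW : IsClosed (W : Set E))
    (hdisj : Disjoint S (W : Set E)) :
    ∃ d ∈ Wᗮ, ∀ s ∈ S, ⟪s, d⟫ < 0 := by
  obtain ⟨f, u, u', hfS, huu', hfW⟩ :=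
    geometric_hahn_banach_compact_closed hconv hcomp W.convex hW hdisj
  have hu' : u' < 0 := by simpa using hfW 0 W.zero_mem
  have hf0 : ∀ w ∈ W, f w = 0 := by
    intro w hw
    by_contra hne
    have h := hfW ((u' / f w) • w) (W.smul_mem _ hw)
    rw [map_smul, smul_eq_mul, div_mul_cancel₀ _ hne] at h
    exact lt_irrefl _ h
  have hd : ∀ x, ⟪x, (InnerProductSpace.toDual ℝ E).symm f⟫ = f x := fun x => by
    rw [real_inner_comm, InnerProductSpace.toDual_symm_apply]
  refine ⟨(InnerProductSpace.toDual ℝ E).symm f, ?_, fun s hs => ?_⟩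
  · rw [Submodule.mem_orthogonal]
    intro w hw
    rw [hd, hf0 w hw]
  · rw [hd]
    exact (hfS s hs).trans (huu'.trans hu')

/-- A vector `d` with `⟪a j, d⟫ < 0` at every index where `c j = 0` can be shrunk so that it has
norm at most one and `⟪a j, d⟫ < c j` for every `j`. -/
theorem exists_pos_smul_norm_le_one_inner_lt {E ι : Type*} [NormedAddCommGroup E]
    [InnerProductSpace ℝ E] [Finite ι] (a : ι → E) (c : ι → ℝ) (hc : ∀ j, 0 ≤ c j) (d : E)
    (hd : ∀ j, c j = 0 → ⟪a j, d⟫ < 0) :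
    ∃ t : ℝ, 0 < t ∧ ‖t • d‖ ≤ 1 ∧ ∀ j, ⟪a j, t • d⟫ < c j := by
  have hpos : ∀ᶠ t : ℝ in nhdsWithin 0 (Set.Ioi 0), 0 < t := self_mem_nhdsWithin
  have hnorm : ∀ᶠ t : ℝ in nhdsWithin 0 (Set.Ioi 0), ‖t • d‖ < 1 := by
    have hcont : Continuous fun t : ℝ => ‖t • d‖ := by fun_prop
    exact (hcont.continuousAt.eventually_lt_const (by simp)).filter_mono nhdsWithin_le_nhds
  have hinner : ∀ j, ∀ᶠ t : ℝ in nhdsWithin 0 (Set.Ioi 0), ⟪a j, t • d⟫ < c j := by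
    intro j
    rcases (hc j).eq_or_lt with h | h
    · filter_upwards [hpos] with t ht
      rw [inner_smul_right, ← h]
      exact mul_neg_of_pos_of_neg ht (hd j h.symm)
    · have hcont : Continuous fun t : ℝ => ⟪a j, t • d⟫ := by fun_prop
      exact (hcont.continuousAt.eventually_lt_const (by simpa using h)).filter_mono
        nhdsWithin_le_nhds
  obtain ⟨t, ht, htn, hti⟩ := (hpos.and (hnorm.and (Filter.eventually_all.2 hinner))).exists
  exact ⟨t, ht, htn.le, hti⟩

/-- **Existence of a strictly feasible descent direction when Fritz–John fails.**
If there are no Fritz–John multipliers `(λ₀, λ, μ) ≠ 0` with `λ₀ ≥ 0`, `λ ≥ 0`,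
`λ_j g_j = 0` and `λ₀ p + ∑ λ_j a_j + ∑ μ_i v_i = 0`, then there exists `d` with
`‖d‖ ≤ 1`, `⟪v i, d⟫ = 0` for all `i`, `⟪p, d⟫ < 0` and `⟪a j, d⟫ < −M g_j` for all `j`. -/
theorem stmt_12 {n m l : ℕ} (p : EuclideanSpace ℝ (Fin n))
    (a : Fin l → EuclideanSpace ℝ (Fin n))
    (v : Fin m → EuclideanSpace ℝ (Fin n))
    (g : Fin l → ℝ) (hg : ∀ j, g j ≤ 0)
    (M : ℝ) (hM : 0 < M)
    (hFJ : ¬ ∃ (lam₀ : ℝ) (lam : Fin l → ℝ) (mu : Fin m → ℝ),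
      0 ≤ lam₀ ∧ (∀ j, 0 ≤ lam j) ∧
      ¬(lam₀ = 0 ∧ lam = 0 ∧ mu = 0) ∧
      (∀ j, lam j * g j = 0) ∧
      lam₀ • p + ∑ j, lam j • a j + ∑ i, mu i • v i = 0) :
    ∃ d : EuclideanSpace ℝ (Fin n), ‖d‖ ≤ 1 ∧ (∀ i, ⟪v i, d⟫ = 0) ∧
      ⟪p, d⟫ < 0 ∧ ∀ j, ⟪a j, d⟫ < -M * g j := by
  let b : Option (Fin l) → EuclideanSpace ℝ (Fin n) := fun k => k.elim p a
  let N : Submodule ℝ (Option (Fin l) → ℝ) :=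
    ⨅ j, LinearMap.ker (g j • LinearMap.proj (R := ℝ) (φ := fun _ => ℝ) (some j))
  have hN : ∀ w, w ∈ N ↔ ∀ j, w (some j) * g j = 0 := fun w => by
    simp [N, Submodule.mem_iInf, or_comm]
  let T : Set (Option (Fin l) → ℝ) := stdSimplex ℝ (Option (Fin l)) ∩ N
  let L := Fintype.linearCombination ℝ b
  have hL : ∀ w, L w = w none • p + ∑ j, w (some j) • a j := fun w => by
    simp [L, b, Fintype.linearCombination_apply, Fintype.sum_option]
  have hconv : Convex ℝ (L '' T) := ((convex_stdSimplex ℝ _).inter N.convex).linear_image L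
  have hcomp : IsCompact (L '' T) :=
    ((isCompact_stdSimplex ℝ _).inter_right N.closed_of_finiteDimensional).image
      L.continuous_of_finiteDimensional
  have hdisj : Disjoint (L '' T) (Submodule.span ℝ (Set.range v) : Set _) := by
    rw [Set.disjoint_left]
    rintro _ ⟨w, ⟨⟨hw0, hw1⟩, hwN⟩, rfl⟩ hspan
    obtain ⟨mu, hmu⟩ := (Submodule.mem_span_range_iff_exists_fun ℝ).1 hspan
    refine hFJ ⟨w none, fun j => w (some j), -mu, hw0 _, fun j => hw0 _, ?_, (hN w).1 hwN, ?_⟩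
    · rintro ⟨h0, h1, -⟩
      rw [Fintype.sum_option, h0] at hw1
      simp [fun j => congrFun h1 j] at hw1
    · rw [← hL, ← hmu]
      simp
  obtain ⟨d, hdW, hdS⟩ := exists_mem_orthogonal_forall_inner_neg hconv hcomp
    (Submodule.closed_of_finiteDimensional _) hdisj
  have hb : ∀ k : Option (Fin l), (∀ j, k = some j → g j = 0) → ⟪b k, d⟫ < 0 := by
    intro k hk
    refine hdS _ ⟨Pi.single k 1, ⟨single_mem_stdSimplex ℝ k, (hN _).2 fun j => ?_⟩, ?_⟩
    · by_cases h : k = some j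
      · rw [hk j h, mul_zero]
      · rw [Pi.single_eq_of_ne (Ne.symm h), zero_mul]
    · simp [L]
  obtain ⟨t, ht, htn, hti⟩ := exists_pos_smul_norm_le_one_inner_lt a (fun j => -M * g j)
    (fun j => mul_nonneg_of_nonpos_of_nonpos (neg_nonpos.2 hM.le) (hg j)) d
    (fun j hj => hb (some j) fun i hi => by
      obtain rfl := Option.some.inj hi
      simpa [hM.ne'] using hj)
  refine ⟨t • d, htn, fun i => ?_, ?_, hti⟩
  · rw [inner_smul_right, Submodule.inner_right_of_mem_orthogonal
      (Submodule.subset_span (Set.mem_range_self i)) hdW, mul_zero]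
  · rw [inner_smul_right]
    exact mul_neg_of_pos_of_neg ht (hb none (by simp))
end

section
/- Let p ∈ ℝⁿ, a₁,…,a_l ∈ ℝⁿ, v₁,…,v_m ∈ ℝⁿ, let g₁,…,g_l ≤ 0 be real numbers, and let M > 0. Suppose the point is not a Fritz–John point. Then the optimal value of the UFD-L2 subproblem — minimize ⟨p, d⟩ over all d ∈ ℝⁿ with ‖d‖₂ ≤ 1, ⟨v_i, d⟩ = 0 for every i, and ⟨a_j, d⟩ ≤ −M g_j for every j — is strictly negative. -/
open scoped RealInnerProductSpace

open scoped Topology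

/-- A Motzkin-type theorem of the alternative: if no convex combination of the finitely many
vectors `c i` lies in the subspace `S`, then some direction orthogonal to `S` makes a negative
inner product with every `c i`. -/
theorem exists_inner_neg_of_convexComb_notMem {E ι : Type*} [NormedAddCommGroup E]
    [InnerProductSpace ℝ E] [FiniteDimensional ℝ E] [Fintype ι] (c : ι → E) (S : Submodule ℝ E)
    (h : ∀ w ∈ stdSimplex ℝ ι, ∑ i, w i • c i ∉ S) :
    ∃ d : E, (∀ s ∈ S, ⟪s, d⟫ = 0) ∧ ∀ i, ⟪c i, d⟫ < 0 := by
  classical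
  have hcompact : IsCompact (Fintype.linearCombination ℝ c '' stdSimplex ℝ ι) :=
    (isCompact_stdSimplex ℝ ι).image (LinearMap.continuous_of_finiteDimensional _)
  have hconvex : Convex ℝ (Fintype.linearCombination ℝ c '' stdSimplex ℝ ι) :=
    (convex_stdSimplex ℝ ι).linear_image _
  have hdisj : Disjoint (Fintype.linearCombination ℝ c '' stdSimplex ℝ ι) (S : Set E) := by
    rw [Set.disjoint_left]
    rintro _ ⟨w, hw, rfl⟩
    exact h w hw
  obtain ⟨f, u, u', hfu, huu', hfu'⟩ := geometric_hahn_banach_compact_closed hconvex hcompact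
    S.convex S.closed_of_finiteDimensional hdisj
  have hu' : u' < 0 := by simpa using hfu' 0 S.zero_mem
  refine ⟨(InnerProductSpace.toDual ℝ E).symm f, fun s hs => ?_, fun i => ?_⟩
  · rw [real_inner_comm, InnerProductSpace.toDual_symm_apply]
    by_contra hne
    have := hfu' ((u' / f s) • s) (S.smul_mem _ hs)
    rw [map_smul, smul_eq_mul, div_mul_cancel₀ _ hne] at this
    exact this.false
  · rw [real_inner_comm, InnerProductSpace.toDual_symm_apply]
    have := hfu (c i) ⟨Pi.single i 1, single_mem_stdSimplex ℝ i, by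
      simp [Fintype.linearCombination_apply_single]⟩
    linarith

/-- Given bounds `b j ≥ 0`, a direction `d` with `⟪a j, d⟫ < 0` whenever `b j = 0` has a positive
multiple in the unit ball that satisfies `⟪a j, ·⟫ ≤ b j` for all `j`. -/
theorem exists_pos_smul_norm_le_one_and_inner_le {E ι : Type*} [NormedAddCommGroup E]
    [InnerProductSpace ℝ E] [Finite ι] (a : ι → E) (b : ι → ℝ) (d : E)
    (h : ∀ j, 0 < b j ∨ 0 ≤ b j ∧ ⟪a j, d⟫ < 0) :
    ∃ t : ℝ, 0 < t ∧ ‖t • d‖ ≤ 1 ∧ ∀ j, ⟪a j, t • d⟫ ≤ b j := by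
  have hnorm : ∀ᶠ t : ℝ in 𝓝[>] 0, ‖t • d‖ ≤ 1 := by
    have hc : Continuous fun t : ℝ => ‖t • d‖ := by fun_prop
    exact nhdsWithin_le_nhds ((hc.tendsto 0).eventually_le_const (by simp))
  have hinner : ∀ᶠ t : ℝ in 𝓝[>] 0, ∀ j, ⟪a j, t • d⟫ ≤ b j := by
    rw [Filter.eventually_all]
    intro j
    rcases h j with hb | ⟨hb, hd⟩
    · have hc : Continuous fun t : ℝ => ⟪a j, t • d⟫ := by fun_prop
      exact nhdsWithin_le_nhds ((hc.tendsto 0).eventually_le_const (by simpa using hb))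
    · filter_upwards [self_mem_nhdsWithin] with t ht
      rw [inner_smul_right]
      exact (mul_neg_of_pos_of_neg ht hd).le.trans hb
  have hpos : ∀ᶠ t : ℝ in 𝓝[>] 0, 0 < t := self_mem_nhdsWithin
  obtain ⟨t, ht, h₁, h₂⟩ := (hpos.and (hnorm.and hinner)).exists
  exact ⟨t, ht, h₁, h₂⟩

/-- **Negative optimal value of the UFD-L2 subproblem at a non-Fritz–John point.**
If there are no Fritz–John multipliers, then the UFD-L2 subproblem
(minimize `⟪p, d⟫` over `‖d‖ ≤ 1`, `⟪v i, d⟫ = 0`, `⟪a j, d⟫ ≤ −M g_j`)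
has strictly negative optimal value, i.e. some feasible `d` has `⟪p, d⟫ < 0`. -/
theorem stmt_13 {n m l : ℕ} (p : EuclideanSpace ℝ (Fin n))
    (a : Fin l → EuclideanSpace ℝ (Fin n))
    (v : Fin m → EuclideanSpace ℝ (Fin n))
    (g : Fin l → ℝ) (hg : ∀ j, g j ≤ 0)
    (M : ℝ) (hM : 0 < M)
    (hFJ : ¬ ∃ (lam₀ : ℝ) (lam : Fin l → ℝ) (mu : Fin m → ℝ),
      0 ≤ lam₀ ∧ (∀ j, 0 ≤ lam j) ∧
      ¬(lam₀ = 0 ∧ lam = 0 ∧ mu = 0) ∧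
      (∀ j, lam j * g j = 0) ∧
      lam₀ • p + ∑ j, lam j • a j + ∑ i, mu i • v i = 0) :
    ∃ d : EuclideanSpace ℝ (Fin n), ‖d‖ ≤ 1 ∧ (∀ i, ⟪v i, d⟫ = 0) ∧
      (∀ j, ⟪a j, d⟫ ≤ -M * g j) ∧ ⟪p, d⟫ < 0 := by
  classical
  let c : Option {j // g j = 0} → EuclideanSpace ℝ (Fin n) := fun o => o.elim p fun j => a j
  have hc : ∀ w ∈ stdSimplex ℝ (Option {j // g j = 0}),
      ∑ o, w o • c o ∉ Submodule.span ℝ (Set.range v) := by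
    intro w hw hmem
    obtain ⟨mu, hmu⟩ := (Submodule.mem_span_range_iff_exists_fun ℝ).1 hmem
    let lam : Fin l → ℝ := fun j => if hj : g j = 0 then w (some ⟨j, hj⟩) else 0
    have hlam : ∀ j : {j // g j = 0}, lam j = w (some j) := fun j => dif_pos j.2
    have hlam' : ∀ j, g j ≠ 0 → lam j = 0 := fun j hj => dif_neg hj
    have hsum : ∑ j, lam j • a j = ∑ j : {j // g j = 0}, w (some j) • a j := by
      simp only [← hlam]
      rw [← Finset.sum_filter_of_ne (p := fun j => g j = 0)]
      · exact Finset.sum_subtype _ (by simp) _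
      · intro j _ hne
        by_contra hj
        exact hne (by rw [hlam' j hj, zero_smul])
    refine hFJ ⟨w none, lam, -mu, hw.1 none, fun j => ?_, ?_, fun j => ?_, ?_⟩
    · by_cases hj : g j = 0
      · exact (hw.1 _).trans_eq (hlam ⟨j, hj⟩).symm
      · exact (hlam' j hj).ge
    · rintro ⟨h₀, h₁, -⟩
      have h₂ := hw.2
      rw [Fintype.sum_option, h₀] at h₂
      simp [← hlam, h₁] at h₂
    · by_cases hj : g j = 0
      · rw [hj, mul_zero]
      · rw [hlam' j hj, zero_mul]
    · rw [Fintype.sum_option] at hmu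
      simp only [Pi.neg_apply, neg_smul, Finset.sum_neg_distrib, hmu, hsum]
      exact add_neg_cancel _
  obtain ⟨d, hdS, hdc⟩ := exists_inner_neg_of_convexComb_notMem c _ hc
  obtain ⟨t, ht, hnorm, hle⟩ := exists_pos_smul_norm_le_one_and_inner_le a (fun j => -M * g j) d
    (fun j => by
      rcases (hg j).lt_or_eq with hj | hj
      · exact Or.inl (mul_pos_of_neg_of_neg (neg_neg_of_pos hM) hj)
      · exact Or.inr ⟨by simp [hj], hdc (some ⟨j, hj⟩)⟩)
  refine ⟨t • d, hnorm, fun i => ?_, hle, ?_⟩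
  · rw [inner_smul_right, hdS _ (Submodule.subset_span ⟨i, rfl⟩), mul_zero]
  · rw [inner_smul_right]
    exact mul_neg_of_pos_of_neg ht (hdc none)
end
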